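/- arXiv:1803.08578 — 3 statements merged into one kernel-verified Lean document; each statement's English description precedes it below -/
import Mathlib

section
/- Let Γ be a family of subsets of ℝ. Assume HD(Γ) holds, i.e., for every A ∈ Γ that is not σ-compact (as a topological subspace of ℝ) there is a Cantor set K ⊆ ℝ such that K \ A is countable and dense in K and K ∩ A is dense in K. Then every member of Γ that has the Menger property is σ-compact. -/
open Set

/-- A topological space is Menger if for every sequence of open covers there are
finite subfamilies whose union covers the space. -/
def IsMenger (X : Type*) [TopologicalSpace X] : Prop :=
  ∀ U : ℕ → Set (Set X),
    (∀ n, (∀ u ∈ U n, IsOpen u) ∧ ⋃₀ U n = Set.univ) →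
    ∃ V : ℕ → Set (Set X),
      (∀ n, V n ⊆ U n ∧ (V n).Finite) ∧ ⋃₀ (⋃ n, V n) = Set.univ

/-- A Cantor set: a subset homeomorphic (in the subspace topology) to the Cantor space `2^ℕ`. -/
def IsCantorSet {X : Type*} [TopologicalSpace X] (K : Set X) : Prop :=
  Nonempty (K ≃ₜ (ℕ → Bool))

/-- Closed ball attached to a node (centre, radius). -/
def nodeBall (q : ℝ × ℝ) : Set ℝ := Metric.closedBall q.1 q.2

/-- Tree of nodes generated by a child function. -/
def nodeTree (q₀ : ℝ × ℝ) (c : ℝ × ℝ → ℕ → ℕ → ℝ × ℝ) : List ℕ → ℝ × ℝ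
  | [] => q₀
  | k :: s => c (nodeTree q₀ c s) s.length k

theorem child_exists {K A : Set ℝ} (h1 : K ⊆ closure (K \ A)) (h2 : K ⊆ closure (K ∩ A))
    (p : ℕ → ℝ) (hp : ∀ n, p n ∉ A) (q : ℝ × ℝ) (n k : ℕ) :
    ∃ q' : ℝ × ℝ, (q.1 ∈ K \ A ∧ 0 < q.2) → ((q'.1 ∈ K \ A ∧ 0 < q'.2) ∧
      nodeBall q' ⊆ nodeBall q ∧ nodeBall q' ⊆ Metric.ball q.1 (1 / ((k : ℝ) + 1)) ∧
      p n ∉ nodeBall q') := by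
  by_cases hq : q.1 ∈ K \ A ∧ 0 < q.2
  swap
  · exact ⟨q, fun h => absurd h hq⟩
  obtain ⟨hqK, hr⟩ := hq
  have hk : (0 : ℝ) < 1 / ((k : ℝ) + 1) := by positivity
  have hB : IsOpen (Metric.ball q.1 q.2 ∩ Metric.ball q.1 (1 / ((k : ℝ) + 1))) :=
    Metric.isOpen_ball.inter Metric.isOpen_ball
  obtain ⟨y, hyB, hyK, hyA⟩ := mem_closure_iff.1 (h2 hqK.1) _ hB
    ⟨Metric.mem_ball_self hr, Metric.mem_ball_self hk⟩
  have hU := hB.inter (isOpen_compl_singleton (x := p n))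
  have hy : y ≠ p n := fun h => hp n (h ▸ hyA)
  obtain ⟨d, hdU, hd⟩ := mem_closure_iff.1 (h1 hyK) _ hU ⟨hyB, hy⟩
  obtain ⟨r, hr0, hrU⟩ := Metric.nhds_basis_closedBall.mem_iff.1 (hU.mem_nhds hdU)
  refine ⟨(d, r), fun _ => ⟨⟨hd, hr0⟩, ?_, ?_, ?_⟩⟩
  · exact fun z hz => Metric.ball_subset_closedBall (hrU hz).1.1
  · exact fun z hz => (hrU hz).1.2
  · exact fun hz => (hrU hz).2 rfl

theorem not_menger_of_cantor {K A : Set ℝ} (hK : IsCompact K) (hne : K.Nonempty)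
    (hc : (K \ A).Countable) (h1 : K ⊆ closure (K \ A)) (h2 : K ⊆ closure (K ∩ A))
    (hM : IsMenger A) : False := by
  have hDne : (K \ A).Nonempty := by
    rw [← closure_nonempty_iff]
    exact hne.mono h1
  obtain ⟨p, hp⟩ := hc.exists_eq_range hDne
  have hpA : ∀ n, p n ∉ A := fun n => by
    have : p n ∈ K \ A := hp ▸ mem_range_self n
    exact this.2
  choose c hcs using child_exists h1 h2 p hpA
  obtain ⟨d₀, hd₀⟩ := hDne
  let t := nodeTree (d₀, 1) c
  have ht : ∀ s, (t s).1 ∈ K \ A ∧ 0 < (t s).2 := by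
    intro s
    induction s with
    | nil => exact ⟨hd₀, one_pos⟩
    | cons k s ih => exact (hcs (t s) s.length k ih).1
  have hsub : ∀ k s, nodeBall (t (k :: s)) ⊆ nodeBall (t s) :=
    fun k s => (hcs (t s) s.length k (ht s)).2.1
  have hsm : ∀ k s, nodeBall (t (k :: s)) ⊆ Metric.ball (t s).1 (1 / ((k : ℝ) + 1)) :=
    fun k s => (hcs (t s) s.length k (ht s)).2.2.1
  have hav : ∀ k s, p s.length ∉ nodeBall (t (k :: s)) :=
    fun k s => (hcs (t s) s.length k (ht s)).2.2.2
  -- local finiteness off D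
  have hfar : ∀ x ∈ A, ∀ s, ∃ N : ℕ, ∃ W ∈ nhds x, ∀ k, N ≤ k →
      ¬ (W ∩ nodeBall (t (k :: s))).Nonempty := by
    intro x hx s
    have hpos : 0 < dist x (t s).1 := dist_pos.2 fun h => (ht s).1.2 (h ▸ hx)
    obtain ⟨N, hN⟩ := exists_nat_one_div_lt (half_pos hpos)
    refine ⟨N, Metric.ball x (dist x (t s).1 / 2), Metric.ball_mem_nhds _ (half_pos hpos), ?_⟩
    rintro k hk ⟨z, hz1, hz2⟩
    have h3 := Metric.mem_ball.1 (hsm k s hz2)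
    have h4 := Metric.mem_ball.1 hz1
    have h5 : 1 / ((k : ℝ) + 1) ≤ 1 / ((N : ℝ) + 1) := Nat.one_div_le_one_div hk
    have h6 := dist_triangle_left x (t s).1 z
    linarith
  have hfin : ∀ x ∈ A, ∀ n : ℕ, ∃ W ∈ nhds x,
      {s : List ℕ | s.length = n ∧ (W ∩ nodeBall (t s)).Nonempty}.Finite := by
    intro x hx n
    induction n with
    | zero =>
      refine ⟨univ, Filter.univ_mem, (finite_singleton ([] : List ℕ)).subset ?_⟩
      rintro s ⟨hs, -⟩
      exact List.length_eq_zero_iff.1 hs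
    | succ n ih =>
      obtain ⟨W, hW, hF⟩ := ih
      choose N V hV hNV using hfar x hx
      refine ⟨W ∩ ⋂ s ∈ {s : List ℕ | s.length = n ∧ (W ∩ nodeBall (t s)).Nonempty}, V s,
        Filter.inter_mem hW ((Filter.biInter_mem hF).2 fun s _ => hV s),
        (hF.biUnion fun s _ => (finite_Iio (N s)).image fun k => k :: s).subset ?_⟩
      rintro (_ | ⟨k, s⟩) ⟨hs, z, ⟨hzW, hzV⟩, hz⟩
      · simp at hs
      · have hmem : s ∈ {s : List ℕ | s.length = n ∧ (W ∩ nodeBall (t s)).Nonempty} :=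
          ⟨by simpa using hs, z, hzW, hsub k s hz⟩
        refine mem_biUnion hmem ⟨k, ?_, rfl⟩
        by_contra hk
        exact hNV s k (not_lt.1 hk) ⟨z, mem_iInter₂.1 hzV s hmem, hz⟩
  -- the covers
  let U : ℕ → Set (Set A) := fun n => {u | IsOpen u ∧ ∃ m : ℕ, ∀ s : List ℕ, s.length = n →
    ∀ k, m ≤ k → ∀ y ∈ u, (y : ℝ) ∉ nodeBall (t (k :: s))}
  obtain ⟨V, hV, hcov⟩ := hM U (by
    intro n
    refine ⟨fun u hu => hu.1, eq_univ_of_forall fun x => ?_⟩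
    obtain ⟨W, hW, hF⟩ := hfin x x.2 (n + 1)
    obtain ⟨O, hOW, hO, hxO⟩ := mem_nhds_iff.1 hW
    obtain ⟨m, hm⟩ := (hF.image fun s => s.headI).bddAbove
    refine ⟨(↑) ⁻¹' O, ⟨hO.preimage continuous_subtype_val, m + 1, ?_⟩, hxO⟩
    intro s hs k hk y hy hyk
    have : k ≤ m := hm ⟨k :: s, ⟨by simp [hs], y, hOW hy, hyk⟩, rfl⟩
    omega)
  have hg : ∀ n, ∃ g : ℕ, ∀ u ∈ V n, ∀ s : List ℕ, s.length = n →
      ∀ y ∈ u, (y : ℝ) ∉ nodeBall (t (g :: s)) := by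
    intro n
    have : ∀ u : Set A, ∃ m : ℕ, u ∈ V n → ∀ s : List ℕ, s.length = n →
        ∀ k, m ≤ k → ∀ y ∈ u, (y : ℝ) ∉ nodeBall (t (k :: s)) := by
      intro u
      by_cases hu : u ∈ V n
      · obtain ⟨m, hm⟩ := ((hV n).1 hu).2
        exact ⟨m, fun _ => hm⟩
      · exact ⟨0, fun h => absurd h hu⟩
    choose m hm using this
    obtain ⟨g, hg⟩ := ((hV n).2.image m).bddAbove
    exact ⟨g, fun u hu s hs => hm u hu s hs g (hg ⟨u, hu, rfl⟩)⟩
  choose g hg using hg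
  let b : ℕ → List ℕ := fun n => Nat.rec [] (fun i l => g i :: l) n
  have hb : ∀ n, b (n + 1) = g n :: b n := fun n => rfl
  have hbl : ∀ n, (b n).length = n := by
    intro n
    induction n with
    | zero => rfl
    | succ n ih => rw [hb, List.length_cons, ih]
  obtain ⟨x, hx⟩ := IsCompact.nonempty_iInter_of_sequence_nonempty_isCompact_isClosed
    (fun n => K ∩ nodeBall (t (b n)))
    (fun n => inter_subset_inter_right _ (hsub (g n) (b n)))
    (fun n => ⟨_, (ht (b n)).1.1, Metric.mem_closedBall_self (ht (b n)).2.le⟩)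
    (hK.inter_right Metric.isClosed_closedBall)
    (fun n => hK.isClosed.inter Metric.isClosed_closedBall)
  have hx' : ∀ n, x ∈ K ∩ nodeBall (t (b n)) := mem_iInter.1 hx
  have hxA : x ∈ A := by
    by_contra hxA
    have : x ∈ K \ A := ⟨(hx' 0).1, hxA⟩
    rw [hp] at this
    obtain ⟨n, rfl⟩ := this
    have h3 := hav (g n) (b n)
    rw [hbl] at h3
    exact h3 (hx' (n + 1)).2
  have : (⟨x, hxA⟩ : A) ∈ ⋃₀ (⋃ n, V n) := hcov ▸ mem_univ _
  obtain ⟨u, hu, hxu⟩ := this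
  obtain ⟨n, hn⟩ := mem_iUnion.1 hu
  exact hg n u hn (b n) (hbl n) _ hxu (hx' (n + 1)).2

/-- If `HD(Γ)` holds for a family `Γ` of subsets of `ℝ`, then every Menger member of `Γ`
is σ-compact. -/
theorem menger_of_HD (Γ : Set (Set ℝ))
    (hHD : ∀ A ∈ Γ, ¬ IsSigmaCompact A →
      ∃ K : Set ℝ, IsCantorSet K ∧ (K \ A).Countable ∧
        K ⊆ closure (K \ A) ∧ K ⊆ closure (K ∩ A)) :
    ∀ A ∈ Γ, IsMenger A → IsSigmaCompact A := by
  intro A hA hM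
  by_contra hs
  obtain ⟨K, ⟨e⟩, hc, h1, h2⟩ := hHD A hA hs
  have : CompactSpace K := e.symm.compactSpace
  exact not_menger_of_cantor (isCompact_iff_compactSpace.2 this)
    ⟨_, (e.symm fun _ => false).2⟩ hc h1 h2 hM
end

section
/- Let X be a topological space and D ⊆ X a countable subset such that X is concentrated around D, i.e., for every open set U ⊆ X with D ⊆ U, the set X \ U is countable. Then X has the Menger property. -/
open Set

/-- A space concentrated around a countable subset has the Menger property. -/
theorem menger_of_concentrated (X : Type*) [TopologicalSpace X]
    (D : Set X) (hD : D.Countable)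
    (hconc : ∀ U : Set X, IsOpen U → D ⊆ U → (Set.univ \ U).Countable) :
    IsMenger X := by
  intro U hU
  have hc : ∀ n x, ∃ u ∈ U n, x ∈ u := fun n x => by
    have hx : x ∈ ⋃₀ U n := by rw [(hU n).2]; trivial
    exact hx
  choose c hcU hcx using hc
  have key : ∀ S : Set X, S.Countable →
      ∃ F : ℕ → Set X, (∀ n, (F n).Finite) ∧ ∀ x ∈ S, ∃ n, x ∈ F n := by
    intro S hS
    obtain ⟨f, hf⟩ := Set.countable_iff_exists_injOn.1 hS
    refine ⟨fun n => {x | x ∈ S ∧ f x = n}, fun n => ?_, fun x hx => ⟨f x, hx, rfl⟩⟩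
    apply Set.Subsingleton.finite
    intro x hx y hy
    exact hf hx.1 hy.1 (hx.2.trans hy.2.symm)
  obtain ⟨F, hF, hFD⟩ := key D hD
  have hW := hconc (⋃ n, ⋃ x ∈ F n, c n x)
    (isOpen_iUnion fun n => isOpen_iUnion fun x => isOpen_iUnion fun _ =>
      (hU n).1 _ (hcU n x))
    (fun x hx => by
      obtain ⟨n, hn⟩ := hFD x hx
      exact mem_iUnion.2 ⟨n, mem_iUnion₂.2 ⟨x, hn, hcx n x⟩⟩)
  obtain ⟨G, hG, hGW⟩ := key _ hW
  refine ⟨fun n => c n '' (F n ∪ G n), fun n => ⟨?_, ((hF n).union (hG n)).image _⟩, ?_⟩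
  · rintro _ ⟨x, _, rfl⟩
    exact hcU n x
  · refine eq_univ_of_forall fun x => ?_
    by_cases hx : x ∈ ⋃ n, ⋃ x ∈ F n, c n x
    · obtain ⟨n, hn⟩ := mem_iUnion.1 hx
      obtain ⟨y, hy, hxy⟩ := mem_iUnion₂.1 hn
      exact ⟨c n y, mem_iUnion.2 ⟨n, y, Or.inl hy, rfl⟩, hxy⟩
    · obtain ⟨n, hn⟩ := hGW x ⟨trivial, hx⟩
      exact ⟨c n x, mem_iUnion.2 ⟨n, x, Or.inr hn, rfl⟩, hcx n x⟩
end

section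
/- Let (b_α)_{α<ω₁} be a ≤*-increasing ω₁-sequence in ℕ^ℕ (α < β implies b_α ≤* b_β) whose range B is dominating: for every h ∈ ℕ^ℕ there is α with h ≤* b_α. Regard ℕ^ℕ as a subspace of (ℕ ∪ {∞})^ℕ, the countable product of the one-point compactification of discrete ℕ, and let D ⊆ (ℕ ∪ {∞})^ℕ be the countable set of functions that are equal to ∞ from some point on. Then X = B ∪ D is concentrated around D: for every set U open in (ℕ ∪ {∞})^ℕ with D ⊆ U, the set X \ U is countable. -/
open Set Filter OnePoint

/-- The first uncountable ordinal `ω₁`, as the type of ordinals below `ℵ₁`. -/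
abbrev Omega1 : Type 1 := {o : Ordinal // o < (Cardinal.aleph 1).ord}

/-- The countable set `D` of members of `(ℕ ∪ {∞})^ℕ` that are equal to `∞` from some
point on. -/
def evInfty : Set (ℕ → OnePoint ℕ) :=
  {f | ∃ N : ℕ, ∀ n ≥ N, f n = ∞}

theorem evInfty_bound (K : Set (ℕ → OnePoint ℕ)) (hK : IsCompact K)
    (hd : ∀ f ∈ K, f ∉ evInfty) (N : ℕ) :
    ∃ m : ℕ, ∀ f ∈ K, ∃ n, N ≤ n ∧ ∃ k : ℕ, k < m ∧ f n = (k : OnePoint ℕ) := by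
  obtain ⟨m, hm⟩ := hK.elim_directed_cover
    (fun m : ℕ => ⋃ n : ℕ, ⋃ _ : N ≤ n,
      (fun f : ℕ → OnePoint ℕ => f n) ⁻¹' ((fun k : ℕ => (k : OnePoint ℕ)) '' Set.Iio m))
    (fun m => isOpen_iUnion fun n => isOpen_iUnion fun _ =>
      (OnePoint.isOpenEmbedding_coe.isOpenMap _ (isOpen_discrete _)).preimage
        (continuous_apply n))
    (by
      intro f hf
      by_contra hcon
      apply hd f hf
      refine ⟨N, fun n hn => ?_⟩
      by_contra hne
      obtain ⟨k, hk⟩ := OnePoint.ne_infty_iff_exists.1 hne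
      apply hcon
      simp only [mem_iUnion, mem_preimage]
      exact ⟨k + 1, n, hn, k, Nat.lt_succ_self k, hk⟩)
    (Monotone.directed_le (by
      intro a c hac f hf
      simp only [mem_iUnion, mem_preimage] at hf ⊢
      obtain ⟨n, hn, k, hk, hkf⟩ := hf
      exact ⟨n, hn, k, lt_of_lt_of_le hk hac, hkf⟩))
  refine ⟨m, fun f hf => ?_⟩
  have h := hm hf
  simp only [mem_iUnion, mem_preimage] at h
  obtain ⟨n, hn, k, hk, hkf⟩ := h
  exact ⟨n, hn, k, hk, hkf.symm⟩

theorem omega1_countable_Iic (α : Omega1) : (Set.Iic α).Countable := by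
  have h1 : (Set.Iio α.1).Countable := by
    rw [← Cardinal.le_aleph0_iff_set_countable, Cardinal.mk_Iio_ordinal]
    have h0 : α.1.card ≤ Cardinal.aleph0 := by
      simpa using Cardinal.lt_ord.1 α.2
    exact Cardinal.lift_le_aleph0.2 h0
  have h2 : (Set.Iic α.1).Countable := by
    rw [← Set.Iio_insert]
    exact h1.insert _
  exact h2.preimage Subtype.val_injective

/-- If `(b_α)_{α<ω₁}` is a `≤*`-increasing dominating sequence in `ℕ^ℕ`, regarded inside
`(ℕ ∪ {∞})^ℕ`, then its range `B` together with `D` is concentrated around `D`. -/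
theorem concentrated_of_dominating_scale
    (b : Omega1 → ℕ → ℕ)
    (hmono : ∀ α β : Omega1, α < β → ∀ᶠ n in atTop, b α n ≤ b β n)
    (hdom : ∀ h : ℕ → ℕ, ∃ α : Omega1, ∀ᶠ n in atTop, h n ≤ b α n) :
    ∀ U : Set (ℕ → OnePoint ℕ), IsOpen U → evInfty ⊆ U →
      (((Set.range fun α : Omega1 => fun n : ℕ => ((b α n : ℕ) : OnePoint ℕ)) ∪ evInfty)
        \ U).Countable := by
  intro U hU hDU
  have hK : IsCompact Uᶜ := hU.isClosed_compl.isCompact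
  choose m hm using evInfty_bound Uᶜ hK (fun f hf hfd => hf (hDU hfd))
  obtain ⟨α, hα⟩ := hdom (fun n => ∑ N ∈ Finset.range (n + 1), m N)
  refine ((omega1_countable_Iic α).image
    (fun α : Omega1 => fun n : ℕ => ((b α n : ℕ) : OnePoint ℕ))).mono ?_
  rintro f ⟨⟨β, rfl⟩ | hf, hfU⟩
  · refine ⟨β, ?_, rfl⟩
    by_contra hβ
    have hlt : α < β := not_le.1 hβ
    obtain ⟨N, hN⟩ := eventually_atTop.1 (hα.and (hmono α β hlt))
    obtain ⟨n, hn, k, hk, hkf⟩ := hm N _ hfU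
    have hk' : b β n = k := OnePoint.coe_injective hkf
    have h1 := hN n hn
    have h2 : m N ≤ ∑ N ∈ Finset.range (n + 1), m N :=
      Finset.single_le_sum (f := m) (fun _ _ => Nat.zero_le _)
        (Finset.mem_range.2 (Nat.lt_succ_of_le hn))
    omega
  · exact absurd (hDU hf) hfU
end
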